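/- arXiv:1202.2071 — 3 statements merged into one kernel-verified Lean document; each statement's English description precedes it below -/
import Mathlib

section
/- There exist k₀ > 0 and C > 0 such that for every k > k₀ there exists an even, k-periodic, twice continuously differentiable function y : ℝ → ℝ solving the second-order equation y''(ξ) - 4 y(ξ) + 6 y(ξ)² = 0 and satisfying sup_{ξ ∈ [-k/2, k/2]} |y(ξ) - sech²(ξ)| ≤ C e^{-k}. -/
open Real

/-- The solitary wave profile `sech²`. -/
noncomputable def sechSq (x : ℝ) : ℝ := (1 / cosh x) ^ 2

/-- The sum of the translates of `G` by the lattice `K ℤ`. -/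
noncomputable def latticeSum (G : ℝ → ℝ) (K x : ℝ) : ℝ := ∑' n : ℤ, G (x - n * K)

lemma sechSq_pos (x : ℝ) : 0 < sechSq x := by
  have := cosh_pos x
  unfold sechSq; positivity

lemma sechSq_neg (x : ℝ) : sechSq (-x) = sechSq x := by simp [sechSq]

lemma sechSq_eq_one_sub_tanh_sq (x : ℝ) : sechSq x = 1 - tanh x ^ 2 := by
  have := (cosh_pos x).ne'
  rw [sechSq, tanh_eq_sinh_div_cosh]
  field_simp
  linarith [cosh_sq x]

lemma sechSq_le_one (x : ℝ) : sechSq x ≤ 1 := by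
  rw [sechSq_eq_one_sub_tanh_sq]; nlinarith [sq_nonneg (tanh x)]

lemma abs_tanh_le_one (x : ℝ) : |tanh x| ≤ 1 := by
  have := sechSq_pos x
  rw [sechSq_eq_one_sub_tanh_sq] at this
  exact abs_le_one_iff_mul_self_le_one.2 (by nlinarith)

lemma exp_abs_le_two_mul_cosh (x : ℝ) : exp |x| ≤ 2 * cosh x := by
  rw [← cosh_abs, cosh_eq]
  linarith [exp_pos (-|x|)]

lemma sechSq_le (x : ℝ) : sechSq x ≤ 4 * exp (-2 * |x|) := by
  have h1 := exp_abs_le_two_mul_cosh x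
  have h2 := exp_pos |x|
  have h3 : 1 / cosh x ≤ 2 * exp (-|x|) := by
    rw [exp_neg, ← div_eq_mul_inv]
    exact (div_le_div_iff₀ (cosh_pos x) h2).2 (by linarith)
  calc sechSq x ≤ (2 * exp (-|x|)) ^ 2 :=
        pow_le_pow_left₀ (by have := cosh_pos x; positivity) h3 2
    _ = 4 * exp (-2 * |x|) := by
        rw [mul_pow, ← exp_nat_mul]; norm_num

lemma hasDerivAt_tanh (x : ℝ) : HasDerivAt tanh (sechSq x) x := by
  have h := (hasDerivAt_sinh x).div (hasDerivAt_cosh x) (cosh_pos x).ne'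
  have he : tanh = sinh / cosh := by
    ext y; simp [tanh_eq_sinh_div_cosh]
  rw [he]
  refine h.congr_deriv ?_
  rw [sechSq, div_pow, one_pow]
  congr 1
  linarith [cosh_sq x]

lemma hasDerivAt_sechSq (x : ℝ) : HasDerivAt sechSq (-2 * sechSq x * tanh x) x := by
  have h := ((hasDerivAt_tanh x).pow 2).const_sub 1
  have he : sechSq = fun y => 1 - (tanh ^ 2) y := by
    ext y; simp [sechSq_eq_one_sub_tanh_sq]
  rw [he]
  refine h.congr_deriv ?_
  simp [sechSq_eq_one_sub_tanh_sq]; ring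

lemma hasDerivAt_sechSq_mul_tanh (x : ℝ) :
    HasDerivAt (fun x => -2 * sechSq x * tanh x) (4 * sechSq x - 6 * sechSq x ^ 2) x := by
  have h := ((hasDerivAt_sechSq x).const_mul (-2)).mul (hasDerivAt_tanh x)
  refine h.congr_deriv ?_
  rw [sechSq_eq_one_sub_tanh_sq]; ring

lemma abs_sechSq_sub_le (x y : ℝ) : |sechSq x - sechSq y| ≤ 2 * |x - y| := by
  have := convex_univ.norm_image_sub_le_of_norm_hasDerivWithin_le (f := sechSq) (C := 2)
    (fun x _ => (hasDerivAt_sechSq x).hasDerivWithinAt) (fun x _ => by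
      rw [norm_mul, norm_mul, norm_eq_abs, norm_eq_abs, norm_eq_abs, abs_of_pos (sechSq_pos x)]
      norm_num
      have := mul_le_mul (sechSq_le_one x) (abs_tanh_le_one x) (abs_nonneg _) zero_le_one
      linarith) (Set.mem_univ y) (Set.mem_univ x)
  simpa using this

lemma summable_exp_neg_abs_int : Summable fun n : ℤ => exp (-|(n : ℝ)|) := by
  have h : Summable fun n : ℕ => exp (-(n : ℝ)) := summable_exp_neg_nat
  refine Summable.of_nat_of_neg ?_ ?_ <;> simpa using h

lemma abs_int_le_abs_mul {K : ℝ} (hK : 1 ≤ K) (n : ℤ) : |(n : ℝ)| ≤ |n * K| := by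
  rw [abs_mul, abs_of_pos (by linarith : 0 < K)]
  nlinarith [abs_nonneg (n : ℝ)]

lemma sechSq_translate_le {K : ℝ} (hK : 1 ≤ K) {x R : ℝ} (hx : |x| ≤ R) (n : ℤ) :
    sechSq (x - n * K) ≤ 4 * exp (2 * R) * exp (-|(n : ℝ)|) := by
  refine (sechSq_le _).trans ?_
  rw [mul_assoc, ← exp_add]
  gcongr
  have h1 : |n * K| - |x| ≤ |x - n * K| := by
    rw [abs_sub_comm]; exact abs_sub_abs_le_abs_sub _ _
  linarith [abs_int_le_abs_mul hK n, abs_nonneg (n : ℝ)]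

lemma summable_translate {K : ℝ} (hK : 1 ≤ K) {G : ℝ → ℝ} {M : ℝ}
    (hG : ∀ x, |G x| ≤ M * sechSq x) (x : ℝ) : Summable fun n : ℤ => G (x - n * K) := by
  have hM : 0 ≤ M := nonneg_of_mul_nonneg_left ((abs_nonneg _).trans (hG 0)) (sechSq_pos 0)
  refine Summable.of_norm_bounded
    (g := fun n : ℤ => M * (4 * exp (2 * |x|) * exp (-|(n : ℝ)|)))
    ((summable_exp_neg_abs_int.mul_left _).mul_left _) fun n => ?_
  exact (hG _).trans (mul_le_mul_of_nonneg_left (sechSq_translate_le hK le_rfl n) hM)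

lemma hasDerivAt_latticeSum {K : ℝ} (hK : 1 ≤ K) {G G' : ℝ → ℝ} {M M' : ℝ}
    (hG : ∀ x, |G x| ≤ M * sechSq x) (hG' : ∀ x, |G' x| ≤ M' * sechSq x)
    (hd : ∀ x, HasDerivAt G (G' x) x) (x : ℝ) :
    HasDerivAt (latticeSum G K) (latticeSum G' K x) x := by
  have hM : 0 ≤ M' := nonneg_of_mul_nonneg_left ((abs_nonneg _).trans (hG' 0)) (sechSq_pos 0)
  have hmem : x ∈ Metric.ball (0 : ℝ) (|x| + 1) := by simp
  refine hasDerivAt_tsum_of_isPreconnected (t := Metric.ball 0 (|x| + 1)) (y₀ := x)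
    (u := fun n : ℤ => M' * (4 * exp (2 * (|x| + 1)) * exp (-|(n : ℝ)|)))
    (g := fun (n : ℤ) y => G (y - n * K)) (g' := fun (n : ℤ) y => G' (y - n * K))
    ((summable_exp_neg_abs_int.mul_left _).mul_left _) Metric.isOpen_ball
    (convex_ball _ _).isPreconnected (fun n y _ => ?_) (fun n y hy => ?_) hmem
    (summable_translate hK hG x) hmem
  · exact (hd _).comp_sub_const y _
  · have hy' : |y| ≤ |x| + 1 := by simpa using (mem_ball_zero_iff.1 hy).le
    exact (hG' _).trans (mul_le_mul_of_nonneg_left (sechSq_translate_le hK hy' n) hM)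

lemma latticeSum_add_period {K : ℝ} (G : ℝ → ℝ) (x : ℝ) :
    latticeSum G K (x + K) = latticeSum G K x := by
  unfold latticeSum
  rw [← (Equiv.addRight (1 : ℤ)).tsum_eq]
  refine tsum_congr fun n => congrArg G ?_
  simp; ring

lemma latticeSum_neg {K : ℝ} {G : ℝ → ℝ} (hG : ∀ x, G (-x) = G x) (x : ℝ) :
    latticeSum G K (-x) = latticeSum G K x := by
  unfold latticeSum
  rw [← (Equiv.neg ℤ).tsum_eq]
  refine tsum_congr fun n => ?_
  rw [← hG]
  refine congrArg G ?_
  simp; ring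

lemma tendsto_tanh_atTop : Filter.Tendsto tanh Filter.atTop (nhds 1) := by
  rw [tendsto_iff_norm_sub_tendsto_zero]
  refine squeeze_zero (fun x => norm_nonneg _) (fun x => ?_) tendsto_exp_neg_atTop_nhds_zero
  have h : tanh x - 1 = -(exp (-x) / cosh x) := by
    have := (cosh_pos x).ne'
    rw [tanh_eq_sinh_div_cosh, ← cosh_sub_sinh]
    field_simp
    ring
  rw [h, norm_neg, norm_of_nonneg (by have := cosh_pos x; positivity)]
  exact div_le_self (exp_pos _).le (one_le_cosh x)

lemma tendsto_tanh_atBot : Filter.Tendsto tanh Filter.atBot (nhds (-1)) := by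
  simpa using (tendsto_tanh_atTop.comp Filter.tendsto_neg_atBot_atTop).neg

lemma hasSum_tanh_sub_tanh {K : ℝ} (hK : 0 < K) (x : ℝ) :
    HasSum (fun n : ℤ => tanh (x - n * K) - tanh (x - n * K - K)) 2 := by
  have hmono : StrictMono tanh := strictMono_of_hasDerivAt_pos hasDerivAt_tanh sechSq_pos
  have hnonneg (y : ℝ) : 0 ≤ tanh y - tanh (y - K) := by
    linarith [hmono (show y - K < y by linarith)]
  have htop : Filter.Tendsto (fun n : ℕ => x + n * K) Filter.atTop Filter.atTop :=
    Filter.tendsto_atTop_add_const_left _ _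
      (tendsto_natCast_atTop_atTop.atTop_mul_const hK)
  have hbot : Filter.Tendsto (fun n : ℕ => x - n * K) Filter.atTop Filter.atBot := by
    simp_rw [sub_eq_add_neg, ← mul_neg]
    exact Filter.tendsto_atBot_add_const_left _ _
      (tendsto_natCast_atTop_atTop.atTop_mul_const_of_neg (by linarith))
  have h1 : HasSum (fun n : ℕ => tanh (x - (n : ℤ) * K) - tanh (x - (n : ℤ) * K - K))
      (tanh x + 1) := by
    rw [hasSum_iff_tendsto_nat_of_nonneg fun n => hnonneg _]
    have h (n : ℕ) : ∑ i ∈ Finset.range n,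
        (tanh (x - (i : ℤ) * K) - tanh (x - (i : ℤ) * K - K)) = tanh x - tanh (x - n * K) := by
      convert Finset.sum_range_sub' (fun i : ℕ => tanh (x - i * K)) n using 2 with i
      · push_cast; ring_nf
      · simp
    simp_rw [h]
    simpa using (tendsto_tanh_atBot.comp hbot).const_sub (tanh x)
  have h2 : HasSum (fun n : ℕ => tanh (x - (-((n : ℤ) + 1) : ℤ) * K)
      - tanh (x - (-((n : ℤ) + 1) : ℤ) * K - K)) (1 - tanh x) := by
    rw [hasSum_iff_tendsto_nat_of_nonneg fun n => hnonneg _]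
    have h (n : ℕ) : ∑ i ∈ Finset.range n, (tanh (x - (-((i : ℤ) + 1) : ℤ) * K)
        - tanh (x - (-((i : ℤ) + 1) : ℤ) * K - K)) = tanh (x + n * K) - tanh x := by
      convert Finset.sum_range_sub (fun i : ℕ => tanh (x + i * K)) n using 2 with i
      · push_cast; ring_nf
      · simp
    simp_rw [h]
    exact (tendsto_tanh_atTop.comp htop).sub_const _
  have h := HasSum.of_nat_of_neg_add_one
    (f := fun n : ℤ => tanh (x - n * K) - tanh (x - n * K - K)) h1 h2
  rwa [show tanh x + 1 + (1 - tanh x) = 2 by ring] at h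

lemma hasSum_tanh_sub_tanh_int_mul {K : ℝ} (hK : 0 < K) (d : ℤ) (x : ℝ) :
    HasSum (fun n : ℤ => tanh (x - n * K) - tanh (x - n * K - d * K)) (2 * d) := by
  induction d with
  | zero => simp
  | succ d ih =>
    convert ih.add (hasSum_tanh_sub_tanh hK (x - d * K)) using 1
    · ext n; push_cast; ring_nf
    · push_cast; ring
  | pred d ih =>
    have h := ih.sub (hasSum_tanh_sub_tanh hK (x - (-d - 1) * K))
    rw [show 2 * ((-d : ℤ) : ℝ) - 2 = 2 * ((-d - 1 : ℤ) : ℝ) by push_cast; ring] at h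
    refine (congrArg (HasSum · _) (funext fun n => ?_)).mp h
    rw [show x - (-d - 1) * K - n * K - K = x - n * K - (-d : ℤ) * K by push_cast; ring,
      show x - (-d - 1) * K - n * K = x - n * K - (-d - 1 : ℤ) * K by push_cast; ring]
    ring

lemma sechSq_mul_sechSq_sub (x : ℝ) {b : ℝ} (hb : b ≠ 0) :
    sechSq x * sechSq (x - b) = 1 / sinh b ^ 2 *
      (-(sechSq x) - sechSq (x - b) + 2 * (cosh b / sinh b) * (tanh x - tanh (x - b))) := by
  have h1 := (cosh_pos x).ne'
  have h2 := (cosh_pos (x - b)).ne'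
  have h3 : sinh b ≠ 0 := by simpa using hb
  have hs : sinh b = sinh x * cosh (x - b) - cosh x * sinh (x - b) := by
    rw [← sinh_sub]; ring_nf
  have hc : cosh b = cosh x * cosh (x - b) - sinh x * sinh (x - b) := by
    rw [← cosh_sub]; ring_nf
  have ht : tanh x - tanh (x - b) = sinh b / (cosh x * cosh (x - b)) := by
    rw [tanh_eq_sinh_div_cosh, tanh_eq_sinh_div_cosh, hs]
    field_simp
  have hcoth : cosh b / sinh b * (tanh x - tanh (x - b)) = 1 - tanh x * tanh (x - b) := by
    rw [ht, tanh_eq_sinh_div_cosh, tanh_eq_sinh_div_cosh]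
    field_simp
    exact hc
  have hprod : sechSq x * sechSq (x - b) = 1 / sinh b ^ 2 * (tanh x - tanh (x - b)) ^ 2 := by
    rw [ht, sechSq, sechSq]
    field_simp
  rw [hprod, sechSq_eq_one_sub_tanh_sq, sechSq_eq_one_sub_tanh_sq, mul_assoc 2, hcoth]
  ring

lemma exp_abs_div_four_le_abs_sinh {x : ℝ} (hx : 1 ≤ |x|) : exp |x| / 4 ≤ |sinh x| := by
  have h1 : exp (-|x|) ≤ 1 := exp_le_one_iff.2 (by linarith)
  have h2 := add_one_le_exp |x|
  rw [abs_sinh, sinh_eq]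
  linarith

lemma exp_neg_two_mul_abs_mul_le {K : ℝ} (hK : 1 ≤ K) {d : ℤ} (hd : d ≠ 0) :
    (|(d : ℝ)| + 1) * exp (-2 * |d * K|) ≤ 2 * exp 1 * exp (-2 * K) * exp (-|(d : ℝ)|) := by
  have h1 : 1 ≤ |(d : ℝ)| := by exact_mod_cast Int.one_le_abs hd
  have h2 : |(d : ℝ)| + 1 ≤ 2 * exp (|(d : ℝ)| - 1) := by
    linarith [add_one_le_exp (|(d : ℝ)| - 1)]
  calc (|(d : ℝ)| + 1) * exp (-2 * |d * K|)
      ≤ 2 * exp (|(d : ℝ)| - 1) * exp (-2 * |d * K|) := by gcongr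
    _ = 2 * exp (|(d : ℝ)| - 1 - 2 * |d * K|) := by
        rw [mul_assoc, ← exp_add]; ring_nf
    _ ≤ 2 * exp (1 + -2 * K + -|(d : ℝ)|) := by
        gcongr
        rw [abs_mul, abs_of_pos (by linarith : 0 < K)]
        nlinarith
    _ = _ := by rw [exp_add, exp_add]; ring

/-- The sum correcting the linear term in the differential equation of the lattice sum of
`sechSq`; the summand at `d = 0` vanishes. -/
noncomputable def latticeAlpha (K : ℝ) : ℝ := ∑' d : ℤ, 1 / sinh (d * K) ^ 2

/-- The sum giving the constant term in the differential equation of the lattice sum of `sechSq`; the summand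
at `d = 0` vanishes. -/
noncomputable def latticeBeta (K : ℝ) : ℝ :=
  ∑' d : ℤ, d * (cosh (d * K) / sinh (d * K)) * (1 / sinh (d * K) ^ 2)

lemma one_div_sinh_sq_le {x : ℝ} (hx : 1 ≤ |x|) : 1 / sinh x ^ 2 ≤ 16 * exp (-2 * |x|) := by
  have h := exp_abs_div_four_le_abs_sinh hx
  have h0 := exp_pos |x|
  calc 1 / sinh x ^ 2 = 1 / |sinh x| ^ 2 := by rw [sq_abs]
    _ ≤ 1 / (exp |x| / 4) ^ 2 := by gcongr
    _ = 16 * exp (-2 * |x|) := by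
        rw [show -2 * |x| = -((2 : ℕ) * |x|) by push_cast; ring, exp_neg, exp_nat_mul]
        field_simp
        norm_num

lemma abs_cosh_div_sinh_le {x : ℝ} (hx : 1 ≤ |x|) : |cosh x / sinh x| ≤ 4 := by
  have h := exp_abs_div_four_le_abs_sinh hx
  have h0 := exp_pos |x|
  have h1 : cosh x ≤ exp |x| := by
    rw [← cosh_abs, cosh_eq]
    linarith [exp_le_exp.2 (show -|x| ≤ |x| by linarith)]
  rw [abs_div, abs_of_pos (cosh_pos x), div_le_iff₀ (by linarith)]
  linarith

lemma one_le_abs_int_mul {K : ℝ} (hK : 1 ≤ K) {d : ℤ} (hd : d ≠ 0) : 1 ≤ |d * K| :=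
  le_trans (by exact_mod_cast Int.one_le_abs hd) (abs_int_le_abs_mul hK d)

lemma norm_alpha_term_le {K : ℝ} (hK : 1 ≤ K) (d : ℤ) :
    ‖1 / sinh (d * K) ^ 2‖ ≤ 128 * exp 1 * exp (-2 * K) * exp (-|(d : ℝ)|) := by
  rcases eq_or_ne d 0 with rfl | hd
  · simp; positivity
  rw [norm_of_nonneg (by positivity)]
  have h1 := one_div_sinh_sq_le (one_le_abs_int_mul hK hd)
  have h2 := exp_neg_two_mul_abs_mul_le hK hd
  nlinarith [mul_nonneg (abs_nonneg (d : ℝ)) (exp_pos (-2 * |d * K|)).le,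
    exp_pos (-2 * |d * K|)]

lemma norm_beta_term_le {K : ℝ} (hK : 1 ≤ K) (d : ℤ) :
    ‖d * (cosh (d * K) / sinh (d * K)) * (1 / sinh (d * K) ^ 2)‖
      ≤ 128 * exp 1 * exp (-2 * K) * exp (-|(d : ℝ)|) := by
  rcases eq_or_ne d 0 with rfl | hd
  · simp; positivity
  have h0 := one_le_abs_int_mul hK hd
  have h2 := exp_neg_two_mul_abs_mul_le hK hd
  rw [norm_mul, norm_mul, norm_of_nonneg (by positivity : 0 ≤ 1 / sinh (d * K) ^ 2)]
  calc _ ≤ |(d : ℝ)| * 4 * (16 * exp (-2 * |d * K|)) := by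
        gcongr
        · exact le_rfl
        · exact abs_cosh_div_sinh_le h0
        · exact one_div_sinh_sq_le h0
    _ ≤ _ := by nlinarith [exp_pos (-2 * |d * K|)]

lemma summable_alpha {K : ℝ} (hK : 1 ≤ K) : Summable fun d : ℤ => 1 / sinh (d * K) ^ 2 :=
  .of_norm_bounded (summable_exp_neg_abs_int.mul_left _) (norm_alpha_term_le hK)

lemma summable_beta {K : ℝ} (hK : 1 ≤ K) :
    Summable fun d : ℤ => d * (cosh (d * K) / sinh (d * K)) * (1 / sinh (d * K) ^ 2) :=
  .of_norm_bounded (summable_exp_neg_abs_int.mul_left _) (norm_beta_term_le hK)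

lemma exists_abs_latticeAlpha_latticeBeta_le : ∃ A : ℝ, 0 < A ∧ ∀ K, 1 ≤ K →
    |latticeAlpha K| ≤ A * exp (-2 * K) ∧ |latticeBeta K| ≤ A * exp (-2 * K) := by
  have hW : 0 < ∑' n : ℤ, exp (-|(n : ℝ)|) :=
    summable_exp_neg_abs_int.tsum_pos (fun _ => (exp_pos _).le) 0 (exp_pos _)
  refine ⟨128 * exp 1 * ∑' n : ℤ, exp (-|(n : ℝ)|), by positivity, fun K hK => ?_⟩
  have h := summable_exp_neg_abs_int.hasSum.mul_left (128 * exp 1 * exp (-2 * K))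
  rw [mul_right_comm]
  exact ⟨tsum_of_norm_bounded h (norm_alpha_term_le hK),
    tsum_of_norm_bounded h (norm_beta_term_le hK)⟩

lemma continuousOn_latticeAlpha : ContinuousOn latticeAlpha (Set.Ici 1) := by
  refine continuousOn_tsum (u := fun d : ℤ => 128 * exp 1 * 1 * exp (-|(d : ℝ)|)) (fun d => ?_)
    (summable_exp_neg_abs_int.mul_left _) fun d K hK => (norm_alpha_term_le hK d).trans ?_
  · rcases eq_or_ne d 0 with rfl | hd
    · simpa using continuousOn_const
    · refine ContinuousOn.div (by fun_prop) (by fun_prop) fun K hK => ?_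
      have := one_le_abs_int_mul hK hd
      exact pow_ne_zero _ (sinh_ne_zero.2 (abs_pos.1 (by linarith)))
  · have : exp (-2 * K) ≤ 1 := exp_le_one_iff.2 (by linarith [Set.mem_Ici.1 hK])
    gcongr

lemma continuousOn_latticeBeta : ContinuousOn latticeBeta (Set.Ici 1) := by
  refine continuousOn_tsum (u := fun d : ℤ => 128 * exp 1 * 1 * exp (-|(d : ℝ)|)) (fun d => ?_)
    (summable_exp_neg_abs_int.mul_left _) fun d K hK => (norm_beta_term_le hK d).trans ?_
  · rcases eq_or_ne d 0 with rfl | hd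
    · simpa using continuousOn_const
    · have h0 (K : ℝ) (hK : K ∈ Set.Ici (1 : ℝ)) : sinh (d * K) ≠ 0 := by
        have := one_le_abs_int_mul hK hd
        exact sinh_ne_zero.2 (abs_pos.1 (by linarith))
      exact (continuousOn_const.mul (ContinuousOn.div (by fun_prop) (by fun_prop) h0)).mul
        (ContinuousOn.div (by fun_prop) (by fun_prop) fun K hK => pow_ne_zero _ (h0 K hK))
  · have : exp (-2 * K) ≤ 1 := exp_le_one_iff.2 (by linarith [Set.mem_Ici.1 hK])
    gcongr

lemma summable_sechSq_translate {K : ℝ} (hK : 1 ≤ K) (x : ℝ) :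
    Summable fun n : ℤ => sechSq (x - n * K) :=
  summable_translate hK (M := 1) (fun x => by rw [abs_of_pos (sechSq_pos x), one_mul]) x

/-- The correlation of the translates of `sechSq` at distance `d * K`. -/
lemma tsum_sechSq_mul_sechSq {K : ℝ} (hK : 1 ≤ K) (x : ℝ) {d : ℤ} (hd : d ≠ 0) :
    ∑' n : ℤ, sechSq (x - n * K) * sechSq (x - n * K - d * K) =
      -2 * latticeSum sechSq K x * (1 / sinh (d * K) ^ 2)
        + 4 * (d * (cosh (d * K) / sinh (d * K)) * (1 / sinh (d * K) ^ 2)) := by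
  have hb : d * K ≠ 0 := abs_pos.1 (by linarith [one_le_abs_int_mul hK hd])
  have h1 : HasSum (fun n : ℤ => sechSq (x - n * K)) (latticeSum sechSq K x) :=
    (summable_sechSq_translate hK x).hasSum
  have h2 : HasSum (fun n : ℤ => sechSq (x - n * K - d * K)) (latticeSum sechSq K x) := by
    rw [← (Equiv.addRight d).hasSum_iff] at h1
    convert h1 using 2 with n
    simp only [Function.comp, Equiv.coe_addRight]
    push_cast
    ring_nf
  have h3 := hasSum_tanh_sub_tanh_int_mul (by linarith : 0 < K) d x
  have h4 := ((h1.neg.sub h2).add (h3.mul_left (2 * (cosh (d * K) / sinh (d * K))))).mul_left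
    (1 / sinh (d * K) ^ 2)
  simp_rw [← sechSq_mul_sechSq_sub _ hb] at h4
  rw [h4.tsum_eq]
  ring

lemma latticeSum_sechSq_sq {K : ℝ} (hK : 1 ≤ K) (x : ℝ) :
    latticeSum sechSq K x ^ 2 = latticeSum (fun x => sechSq x ^ 2) K x
      - 2 * latticeAlpha K * latticeSum sechSq K x + 4 * latticeBeta K := by
  have hS := summable_sechSq_translate hK x
  have hSS := hS.mul_of_nonneg hS (fun _ => (sechSq_pos _).le) (fun _ => (sechSq_pos _).le)
  let e : ℤ × ℤ ≃ ℤ × ℤ :=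
    { toFun := fun p => (p.2, p.2 + p.1)
      invFun := fun p => (p.2 - p.1, p.1)
      left_inv := fun p => by ext <;> simp
      right_inv := fun p => by ext <;> simp }
  have hSSe := e.summable_iff.2 hSS
  have h1 := (hS.tsum_mul_tsum hS hSS).trans ((e.tsum_eq _).symm.trans hSSe.tsum_prod)
  have h2 (d : ℤ) : ∑' n : ℤ, ((fun p : ℤ × ℤ => sechSq (x - p.1 * K) * sechSq (x - p.2 * K)) ∘ e)
      (d, n) = (if d = 0 then latticeSum (fun x => sechSq x ^ 2) K x else 0) +
        (-2 * latticeSum sechSq K x * (1 / sinh (d * K) ^ 2)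
          + 4 * (d * (cosh (d * K) / sinh (d * K)) * (1 / sinh (d * K) ^ 2))) := by
    rcases eq_or_ne d 0 with rfl | hd
    · simp [e, latticeSum, pow_two]
    · rw [← tsum_sechSq_mul_sechSq hK x hd, if_neg hd, zero_add]
      refine tsum_congr fun n => ?_
      simp only [e, Function.comp, Equiv.coe_fn_mk]
      push_cast
      ring_nf
  have h3 := (hasSum_ite_eq (0 : ℤ) (latticeSum (fun x => sechSq x ^ 2) K x)).add
    (((summable_alpha hK).hasSum.mul_left (-2 * latticeSum sechSq K x)).add
      ((summable_beta hK).hasSum.mul_left 4))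
  simp_rw [h2] at h1
  rw [h3.tsum_eq] at h1
  change latticeSum sechSq K x * latticeSum sechSq K x = _ + (_ * latticeAlpha K
    + 4 * latticeBeta K) at h1
  linarith

lemma exists_abs_latticeSum_sechSq_sub_le : ∃ B : ℝ, 0 < B ∧ ∀ K, 1 ≤ K → ∀ x, |x| ≤ K / 2 →
    |latticeSum sechSq K x - sechSq x| ≤ B * exp (-K) := by
  have hW : 0 < ∑' n : ℤ, exp (-|(n : ℝ)|) :=
    summable_exp_neg_abs_int.tsum_pos (fun _ => (exp_pos _).le) 0 (exp_pos _)
  refine ⟨4 * exp 1 * ∑' n : ℤ, exp (-|(n : ℝ)|), by positivity, fun K hK x hx => ?_⟩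
  have h : latticeSum sechSq K x = sechSq (x - (0 : ℤ) * K)
      + ∑' n : ℤ, if n = 0 then 0 else sechSq (x - n * K) :=
    (summable_sechSq_translate hK x).tsum_eq_add_tsum_ite 0
  rw [h, Int.cast_zero, zero_mul, sub_zero, add_sub_cancel_left, mul_right_comm, ← norm_eq_abs]
  refine tsum_of_norm_bounded (summable_exp_neg_abs_int.hasSum.mul_left (4 * exp 1 * exp (-K)))
    fun n => ?_
  split_ifs with hn
  · simp; positivity
  rw [norm_of_nonneg (sechSq_pos _).le, mul_assoc 4, ← exp_add, mul_assoc, ← exp_add]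
  refine (sechSq_le _).trans ?_
  gcongr
  have h1 : |n * K| - |x| ≤ |x - n * K| := by
    rw [abs_sub_comm]; exact abs_sub_abs_le_abs_sub _ _
  have h2 : 1 ≤ |(n : ℝ)| := by exact_mod_cast Int.one_le_abs hn
  rw [abs_mul, abs_of_pos (by linarith : 0 < K)] at h1
  nlinarith

lemma hasDerivAt_latticeSum_sechSq {K : ℝ} (hK : 1 ≤ K) (x : ℝ) :
    HasDerivAt (latticeSum sechSq K) (latticeSum (fun x => -2 * sechSq x * tanh x) K x) x := by
  refine hasDerivAt_latticeSum hK (M := 1) (M' := 2) (fun x => ?_) (fun x => ?_)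
    hasDerivAt_sechSq x
  · rw [abs_of_pos (sechSq_pos x), one_mul]
  · have h0 := sechSq_pos x
    rw [abs_mul, abs_mul, abs_of_pos h0, abs_neg, abs_two]
    exact mul_le_of_le_one_right (by positivity) (abs_tanh_le_one x)

lemma hasDerivAt_deriv_latticeSum_sechSq {K : ℝ} (hK : 1 ≤ K) (x : ℝ) :
    HasDerivAt (latticeSum (fun x => -2 * sechSq x * tanh x) K)
      ((4 - 12 * latticeAlpha K) * latticeSum sechSq K x - 6 * latticeSum sechSq K x ^ 2
        + 24 * latticeBeta K) x := by
  have hsq (x : ℝ) : |sechSq x ^ 2| ≤ 1 * sechSq x := by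
    rw [abs_of_nonneg (sq_nonneg _)]
    nlinarith [sechSq_pos x, sechSq_le_one x]
  have h := hasDerivAt_latticeSum hK (M := 2) (M' := 10) (fun x => ?_) (fun x => ?_)
    hasDerivAt_sechSq_mul_tanh x
  · refine h.congr_deriv ?_
    have hsum : latticeSum (fun x => 4 * sechSq x - 6 * sechSq x ^ 2) K x
        = 4 * latticeSum sechSq K x - 6 * latticeSum (fun x => sechSq x ^ 2) K x :=
      (((summable_sechSq_translate hK x).hasSum.mul_left 4).sub
        ((summable_translate hK hsq x).hasSum.mul_left 6)).tsum_eq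
    rw [hsum]
    linarith [latticeSum_sechSq_sq hK x]
  · have h0 := sechSq_pos x
    rw [abs_mul, abs_mul, abs_of_pos h0, abs_neg, abs_two]
    exact mul_le_of_le_one_right (by positivity) (abs_tanh_le_one x)
  · have h0 := sechSq_pos x
    have h1 := hsq x
    rw [abs_of_nonneg (sq_nonneg _)] at h1
    rw [abs_le]
    constructor <;> nlinarith [sq_nonneg (sechSq x)]

/-- An affine rescaling of the lattice sum of `sechSq` solves the equation, provided that the
scale `a` compensates for the interaction of the translates. -/
lemma cnoidal_equation {K a : ℝ} (hK : 1 ≤ K)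
    (ha : a ^ 4 * ((4 - 12 * latticeAlpha K) ^ 2 + 576 * latticeBeta K) = 16) {y : ℝ → ℝ}
    (hy : ∀ ξ, y ξ = a ^ 2 * latticeSum sechSq K (a * ξ)
      + (4 - a ^ 2 * (4 - 12 * latticeAlpha K)) / 12) :
    ContDiff ℝ 2 y ∧ ∀ ξ, deriv (deriv y) ξ - 4 * y ξ + 6 * y ξ ^ 2 = 0 := by
  have hmul (ξ : ℝ) : HasDerivAt (fun ξ => a * ξ) a ξ := by
    simpa using (hasDerivAt_id ξ).const_mul a
  have h1 (ξ : ℝ) : HasDerivAt y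
      (a ^ 3 * latticeSum (fun x => -2 * sechSq x * tanh x) K (a * ξ)) ξ := by
    rw [funext hy]
    refine (((hasDerivAt_latticeSum_sechSq hK (a * ξ)).comp ξ (hmul ξ)).const_mul
      (a ^ 2)).add_const _ |>.congr_deriv ?_
    ring
  have hd1 : deriv y = fun ξ =>
      a ^ 3 * latticeSum (fun x => -2 * sechSq x * tanh x) K (a * ξ) :=
    funext fun ξ => (h1 ξ).deriv
  have h2 (ξ : ℝ) : HasDerivAt (deriv y) (4 * y ξ - 6 * y ξ ^ 2) ξ := by
    rw [hd1]
    refine ((hasDerivAt_deriv_latticeSum_sechSq hK (a * ξ)).comp ξ (hmul ξ)).const_mul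
      (a ^ 3) |>.congr_deriv ?_
    rw [hy]
    linear_combination (1 / 24) * ha
  have hd2 : deriv (deriv y) = fun ξ => 4 * y ξ - 6 * y ξ ^ 2 := funext fun ξ => (h2 ξ).deriv
  have hdiff : Differentiable ℝ y := fun ξ => (h1 ξ).differentiableAt
  refine ⟨?_, fun ξ => by rw [hd2]; ring⟩
  rw [show (2 : WithTop ℕ∞) = 1 + 1 by norm_num, contDiff_succ_iff_deriv]
  refine ⟨hdiff, by simp, ?_⟩
  rw [contDiff_one_iff_deriv]
  refine ⟨fun ξ => (h2 ξ).differentiableAt, ?_⟩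
  rw [hd2]
  have := hdiff.continuous
  fun_prop

lemma abs_sub_one_le_abs_sq_sub_one {a : ℝ} (ha : 0 ≤ a) : |a - 1| ≤ |a ^ 2 - 1| := by
  rw [show a ^ 2 - 1 = (a - 1) * (a + 1) by ring, abs_mul, abs_of_nonneg (by linarith : 0 ≤ a + 1)]
  exact le_mul_of_one_le_right (abs_nonneg _) (by linarith)

/-- The scale that makes the rescaled lattice sum a solution, with its asymptotics. -/
lemma exists_scale : ∃ (K₁ M : ℝ) (a : ℝ → ℝ), 1 ≤ K₁ ∧ 0 < M ∧ ContinuousOn a (Set.Ici K₁) ∧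
    ∀ K, K₁ ≤ K →
      a K ^ 4 * ((4 - 12 * latticeAlpha K) ^ 2 + 576 * latticeBeta K) = 16 ∧
      |a K - 1| ≤ 1 / 2 ∧ |a K - 1| ≤ M * exp (-2 * K) ∧ a K ^ 2 ≤ 2 ∧
      |a K ^ 2 - 1| ≤ M * exp (-2 * K) ∧
      |(4 - a K ^ 2 * (4 - 12 * latticeAlpha K)) / 12| ≤ M * exp (-2 * K) := by
  obtain ⟨A, hA, hAK⟩ := exists_abs_latticeAlpha_latticeBeta_le
  set N : ℝ := 672 * A + 144 * A ^ 2 with hN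
  have hN0 : 0 < N := by positivity
  set D : ℝ → ℝ := fun K => (4 - 12 * latticeAlpha K) ^ 2 + 576 * latticeBeta K with hD
  have hclose (K : ℝ) (hK : 1 + N ≤ K) : |D K - 16| ≤ N * exp (-2 * K) ∧ |D K - 16| ≤ 1 := by
    obtain ⟨h1, h2⟩ := hAK K (by linarith)
    have he : exp (-2 * K) ≤ 1 := exp_le_one_iff.2 (by linarith)
    have he0 := exp_pos (-2 * K)
    have hsmall : N * exp (-2 * K) ≤ 1 := by
      rw [show -2 * K = -(2 * K) by ring, exp_neg, ← div_eq_mul_inv, div_le_one (exp_pos _)]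
      linarith [add_one_le_exp (2 * K)]
    have h3 : latticeAlpha K ^ 2 ≤ A ^ 2 * exp (-2 * K) := by
      rw [← sq_abs]
      calc |latticeAlpha K| ^ 2 ≤ (A * exp (-2 * K)) ^ 2 := by gcongr
        _ = A ^ 2 * exp (-2 * K) * exp (-2 * K) := by ring
        _ ≤ A ^ 2 * exp (-2 * K) := mul_le_of_le_one_right (by positivity) he
    have h4 : |D K - 16| ≤ N * exp (-2 * K) := by
      rw [abs_le] at h1 h2 ⊢
      simp only [hD, hN]
      constructor <;> nlinarith [sq_nonneg (latticeAlpha K), mul_pos (pow_pos hA 2) he0]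
    exact ⟨h4, h4.trans hsmall⟩
  have hDpos (K : ℝ) (hK : 1 + N ≤ K) : 15 ≤ D K := by
    linarith [(abs_le.1 (hclose K hK).2).1]
  refine ⟨1 + N, N + 2 * A, fun K => √(√(16 / D K)), by linarith, by positivity, ?_,
    fun K hK => ?_⟩
  · have hsub : Set.Ici (1 + N) ⊆ Set.Ici 1 := Set.Ici_subset_Ici.2 (by linarith)
    have hα := continuousOn_latticeAlpha.mono hsub
    have hβ := continuousOn_latticeBeta.mono hsub
    have hDc : ContinuousOn D (Set.Ici (1 + N)) :=
      ((continuousOn_const.sub (continuousOn_const.mul hα)).pow 2).add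
        (continuousOn_const.mul hβ)
    exact (continuousOn_const.div hDc fun K hK => by
      linarith [hDpos K hK] |> ne_of_gt).sqrt.sqrt
  · obtain ⟨h1, h2⟩ := hclose K hK
    have h3 := hDpos K hK
    have hα := (hAK K (by linarith)).1
    have he0 := exp_pos (-2 * K)
    set a := √(√(16 / D K))
    have ha0 : 0 ≤ a := sqrt_nonneg _
    have ha4 : (a ^ 2) ^ 2 = 16 / D K := by
      rw [sq_sqrt (sqrt_nonneg _), sq_sqrt (by positivity)]
    have h5 : |(a ^ 2) ^ 2 - 1| ≤ |D K - 16| / 15 := by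
      rw [ha4, show 16 / D K - 1 = -(D K - 16) / D K by field_simp; ring, abs_div, abs_neg,
        abs_of_pos (by linarith : 0 < D K)]
      gcongr
    have h6 := abs_sub_one_le_abs_sq_sub_one (sq_nonneg a)
    have h7 := abs_sub_one_le_abs_sq_sub_one ha0
    have h8 : |D K - 16| / 15 ≤ |D K - 16| := by linarith [abs_nonneg (D K - 16)]
    have hA' : 0 < A * exp (-2 * K) := by positivity
    have h9 : a ^ 2 ≤ 2 := by linarith [le_abs_self (a ^ 2 - 1)]
    refine ⟨?_, by linarith, by linarith, h9, by linarith, ?_⟩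
    · change a ^ 4 * D K = 16
      rw [show a ^ 4 = (a ^ 2) ^ 2 by ring, ha4]
      field_simp
    · have h10 : |a ^ 2 * latticeAlpha K| ≤ 2 * (A * exp (-2 * K)) := by
        rw [abs_mul, abs_of_nonneg (sq_nonneg a)]
        gcongr
      have h11 : |a ^ 2 - 1| ≤ N * exp (-2 * K) := by linarith
      rw [abs_le] at h10 h11 ⊢
      constructor <;> linarith

/-- Existence of the cnoidal wave: for every large period `k` there is an even,
`k`-periodic `C²` solution of `y'' - 4y + 6y² = 0` exponentially close to the
solitary wave `sech²(ξ)` on the fundamental period `[-k/2, k/2]`. -/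
theorem cnoidal_wave_close_to_soliton :
    ∃ k₀ C : ℝ, 0 < k₀ ∧ 0 < C ∧
      ∀ k : ℝ, k₀ < k →
        ∃ y : ℝ → ℝ,
          (∀ ξ : ℝ, y (-ξ) = y ξ) ∧
          (∀ ξ : ℝ, y (ξ + k) = y ξ) ∧
          ContDiff ℝ 2 y ∧
          (∀ ξ : ℝ, deriv (deriv y) ξ - 4 * y ξ + 6 * (y ξ) ^ 2 = 0) ∧
          ∀ ξ ∈ Set.Icc (-k/2) (k/2),
            |y ξ - (1 / Real.cosh ξ) ^ 2| ≤ C * Real.exp (-k) := by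
  obtain ⟨K₁, M, a, hK₁, hM, hcont, hscale⟩ := exists_scale
  obtain ⟨B, hB, hclose⟩ := exists_abs_latticeSum_sechSq_sub_le
  refine ⟨2 * K₁, 2 * B * exp M + 2 * M + M * exp (2 * M), by linarith, by positivity,
    fun k hk => ?_⟩
  obtain ⟨K, ⟨hKl, -⟩, hKk⟩ : ∃ K ∈ Set.Icc (k / 2) (2 * k), K - k * a K = 0 := by
    have hsub : Set.Icc (k / 2) (2 * k) ⊆ Set.Ici K₁ := fun K hK => by
      have := hK.1
      simp only [Set.mem_Ici]
      linarith
    have hc : ContinuousOn (fun K => K - k * a K) (Set.Icc (k / 2) (2 * k)) :=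
      continuousOn_id.sub (continuousOn_const.mul (hcont.mono hsub))
    refine intermediate_value_Icc (by linarith) hc ⟨?_, ?_⟩
    · have := (abs_le.1 (hscale (k / 2) (by linarith)).2.1).1
      nlinarith
    · have := (abs_le.1 (hscale (2 * k) (by linarith)).2.1).2
      nlinarith
  obtain ⟨ha4, hahalf, ha1, ha2, ha2', hc⟩ := hscale K (by linarith)
  have hK : 1 ≤ K := by linarith
  have hk0 : 0 < k := by linarith
  set c := (4 - a K ^ 2 * (4 - 12 * latticeAlpha K)) / 12
  have hKe : K = a K * k := by linarith
  have ha0 : 0 < a K := by linarith [(abs_le.1 hahalf).1]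
  obtain ⟨hy2, hyeq⟩ := cnoidal_equation hK ha4
    (y := fun ξ => a K ^ 2 * latticeSum sechSq K (a K * ξ) + c) fun _ => rfl
  refine ⟨_, fun ξ => ?_, fun ξ => ?_, hy2, hyeq, fun ξ hξ => ?_⟩
  · simp only [mul_neg, latticeSum_neg sechSq_neg]
  · simp only [mul_add, ← hKe, latticeSum_add_period]
  have hξ' : |ξ| ≤ k / 2 := abs_le.2 ⟨by linarith [hξ.1], hξ.2⟩
  have hkexp : k * exp (-k) ≤ 1 := by
    rw [exp_neg, ← div_eq_mul_inv, div_le_one (exp_pos _)]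
    linarith [add_one_le_exp k]
  have heps : exp (-2 * K) ≤ exp (-k) := exp_le_exp.2 (by linarith)
  have hshift : |K - k| ≤ M := by
    calc |K - k| = |a K - 1| * k := by
          conv_lhs => rw [hKe, show a K * k - k = (a K - 1) * k by ring, abs_mul, abs_of_pos hk0]
      _ ≤ M * exp (-k) * k := by gcongr; exact ha1.trans (by gcongr)
      _ = M * (k * exp (-k)) := by ring
      _ ≤ M := mul_le_of_le_one_right hM.le hkexp
  have hshift' := (abs_le.1 hshift).1
  have heps' : exp (-2 * K) ≤ exp (2 * M) * exp (-k) * exp (-k) := by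
    rw [← exp_add, ← exp_add]
    exact exp_le_exp.2 (by linarith)
  have hexpK : exp (-K) ≤ exp M * exp (-k) := by
    rw [← exp_add]
    exact exp_le_exp.2 (by linarith)
  have hx : |a K * ξ| ≤ K / 2 := by
    rw [abs_mul, abs_of_pos ha0]
    nlinarith
  have e1 : |a K ^ 2 * (latticeSum sechSq K (a K * ξ) - sechSq (a K * ξ))|
      ≤ 2 * B * exp M * exp (-k) := by
    rw [abs_mul, abs_of_nonneg (sq_nonneg _)]
    calc _ ≤ 2 * (B * (exp M * exp (-k))) := by
          gcongr
          exact (hclose K hK _ hx).trans (by gcongr)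
      _ = _ := by ring
  have e2 : |(a K ^ 2 - 1) * sechSq (a K * ξ)| ≤ M * exp (-k) := by
    rw [abs_mul, abs_of_pos (sechSq_pos _)]
    refine (mul_le_of_le_one_right (abs_nonneg _) (sechSq_le_one _)).trans (ha2'.trans ?_)
    gcongr
  have e3 : |sechSq (a K * ξ) - sechSq ξ| ≤ M * exp (2 * M) * exp (-k) := by
    calc _ ≤ 2 * |a K * ξ - ξ| := abs_sechSq_sub_le _ _
      _ = 2 * (|a K - 1| * |ξ|) := by rw [← abs_mul]; ring_nf
      _ ≤ 2 * (M * (exp (2 * M) * exp (-k) * exp (-k)) * (k / 2)) := by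
          gcongr
          exact ha1.trans (by gcongr)
      _ = M * exp (2 * M) * exp (-k) * (k * exp (-k)) := by ring
      _ ≤ _ := mul_le_of_le_one_right (by positivity) hkexp
  have e4 : |c| ≤ M * exp (-k) := hc.trans (by gcongr)
  rw [show a K ^ 2 * latticeSum sechSq K (a K * ξ) + c - (1 / cosh ξ) ^ 2 =
    a K ^ 2 * (latticeSum sechSq K (a K * ξ) - sechSq (a K * ξ)) + (a K ^ 2 - 1) * sechSq (a K * ξ)
      + (sechSq (a K * ξ) - sechSq ξ) + c by simp only [sechSq]; ring]
  refine (abs_add_le _ _).trans ?_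
  linarith [abs_add_three (a K ^ 2 * (latticeSum sechSq K (a K * ξ) - sechSq (a K * ξ)))
    ((a K ^ 2 - 1) * sechSq (a K * ξ)) (sechSq (a K * ξ) - sechSq ξ)]
end

section
/- Define ψ(ξ,τ) = (1/8)(3 + 4 cosh(ξ/2) e^{τ/4} + cosh(ξ) e^{τ}) and w(ξ,τ) = ∂_ξψ(ξ,τ)/ψ(ξ,τ) for ξ ∈ ℝ, τ ≥ 0. Then: (i) ψ satisfies the heat equation ∂_τψ = ∂_ξ²ψ with ψ(ξ,0) = cosh⁴(ξ/4); (ii) w satisfies the viscous Burgers equation ∂_τ w = 2w ∂_ξ w + ∂_ξ² w with w(ξ,0) = tanh(ξ/4); and (iii) for every integer m ≥ 0 there is a constant C_m > 0 such that sup_{ξ ∈ ℝ} | e^{|ξ|/2} ∂_ξ^m ( w(ξ,τ) - tanh(ξ) ) | ≤ C_m e^{-3τ/4} for all τ ≥ 0. -/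
open Real

/-- The explicit Cole–Hopf heat solution `ψ(ξ,τ) = (1/8)(3 + 4cosh(ξ/2)e^{τ/4} + cosh(ξ)e^τ)`. -/
noncomputable def ψ (ξ τ : ℝ) : ℝ :=
  (1/8) * (3 + 4 * Real.cosh (ξ/2) * Real.exp (τ/4) + Real.cosh ξ * Real.exp τ)

/-- The corresponding Burgers solution `w = ∂_ξψ/ψ`. -/
noncomputable def w (ξ τ : ℝ) : ℝ :=
  deriv (fun y => ψ y τ) ξ / ψ ξ τ

/-- Finite sums of terms `c * exp (a' * τ) * exp (b' * ξ)` with `a' ≤ a` and `|b'| ≤ b`,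
as functions of `τ` and `ξ`. -/
inductive IsExpSum (a b : ℝ) : (ℝ → ℝ → ℝ) → Prop
  | exp (c : ℝ) {a' b' : ℝ} (ha : a' ≤ a) (hb : |b'| ≤ b) :
      IsExpSum a b (fun τ ξ => c * (Real.exp (a' * τ) * Real.exp (b' * ξ)))
  | add {F G : ℝ → ℝ → ℝ} : IsExpSum a b F → IsExpSum a b G →
      IsExpSum a b (fun τ ξ => F τ ξ + G τ ξ)

namespace IsExpSum

variable {a b a₁ b₁ : ℝ} {F G : ℝ → ℝ → ℝ}

theorem mono (hF : IsExpSum a b F) (ha : a ≤ a₁) (hb : b ≤ b₁) : IsExpSum a₁ b₁ F := by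
  induction hF with
  | exp c ha' hb' => exact exp c (ha'.trans ha) (hb'.trans hb)
  | add _ _ ihF ihG => exact add ihF ihG

theorem const_mul (k : ℝ) (hF : IsExpSum a b F) : IsExpSum a b (fun τ ξ => k * F τ ξ) := by
  induction hF with
  | exp c ha hb => simpa only [mul_assoc] using exp (k * c) ha hb
  | add _ _ ihF ihG => simpa only [mul_add] using add ihF ihG

theorem sub (hF : IsExpSum a b F) (hG : IsExpSum a b G) :
    IsExpSum a b (fun τ ξ => F τ ξ - G τ ξ) := by
  simpa [sub_eq_add_neg] using hF.add (hG.const_mul (-1))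

theorem mul (hF : IsExpSum a b F) (hG : IsExpSum a₁ b₁ G) :
    IsExpSum (a + a₁) (b + b₁) (fun τ ξ => F τ ξ * G τ ξ) := by
  induction hF with
  | @exp c a' b' ha hb =>
    induction hG with
    | @exp c₁ a₁' b₁' ha₁ hb₁ =>
      convert exp (a := a + a₁) (b := b + b₁) (c * c₁) (add_le_add ha ha₁)
        ((abs_add_le b' b₁').trans (add_le_add hb hb₁)) using 3
      rw [add_mul, add_mul, Real.exp_add, Real.exp_add]
      ring
    | add _ _ ihF ihG => simpa only [mul_add] using add ihF ihG
  | add _ _ ihF ihG => simpa only [add_mul] using add ihF ihG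

theorem const (k : ℝ) : IsExpSum 0 0 (fun _ _ => k) := by
  simpa using exp (a := 0) (b := 0) k (a' := 0) (b' := 0) le_rfl (by simp)

theorem exp_time (k : ℝ) : IsExpSum k 0 (fun τ _ => Real.exp (k * τ)) := by
  simpa using exp (a := k) (b := 0) 1 (b' := 0) le_rfl (by simp)

theorem cosh (k : ℝ) : IsExpSum 0 |k| (fun _ ξ => Real.cosh (k * ξ)) := by
  convert (exp (a := 0) (b := |k|) (1 / 2) (a' := 0) (b' := k) le_rfl le_rfl).add
    (exp (1 / 2) (a' := 0) (b' := -k) le_rfl (abs_neg k).le) using 3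
  rw [Real.cosh_eq, zero_mul, Real.exp_zero, neg_mul]
  ring

theorem sinh (k : ℝ) : IsExpSum 0 |k| (fun _ ξ => Real.sinh (k * ξ)) := by
  convert (exp (a := 0) (b := |k|) (1 / 2) (a' := 0) (b' := k) le_rfl le_rfl).add
    (exp (-1 / 2) (a' := 0) (b' := -k) le_rfl (abs_neg k).le) using 3
  rw [Real.sinh_eq, zero_mul, Real.exp_zero, neg_mul]
  ring

theorem exists_hasDerivAt (hF : IsExpSum a b F) :
    ∃ F', IsExpSum a b F' ∧ ∀ τ ξ, HasDerivAt (F τ) (F' τ ξ) ξ := by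
  induction hF with
  | @exp c a' b' ha hb =>
    refine ⟨_, exp (c * b') ha hb, fun τ ξ => ?_⟩
    have h := (((hasDerivAt_id ξ).const_mul b').exp.const_mul (Real.exp (a' * τ))).const_mul c
    refine h.congr_deriv ?_
    simp only [id]
    ring
  | add _ _ ihF ihG =>
    obtain ⟨F', hF', hF⟩ := ihF
    obtain ⟨G', hG', hG⟩ := ihG
    exact ⟨_, hF'.add hG', fun τ ξ => (hF τ ξ).add (hG τ ξ)⟩

theorem exists_bound (hF : IsExpSum a b F) :
    ∃ C : ℝ, 0 < C ∧ ∀ τ, 0 ≤ τ → ∀ ξ,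
      |F τ ξ| ≤ C * (Real.exp (a * τ) * Real.exp (b * |ξ|)) := by
  induction hF with
  | @exp c a' b' ha hb =>
    refine ⟨|c| + 1, by positivity, fun τ hτ ξ => ?_⟩
    rw [abs_mul, abs_of_pos (by positivity : 0 < Real.exp (a' * τ) * Real.exp (b' * ξ))]
    have hξ : b' * ξ ≤ b * |ξ| :=
      (le_abs_self _).trans ((abs_mul b' ξ).trans_le (by gcongr))
    gcongr
    linarith
  | add _ _ ihF ihG =>
    obtain ⟨C, hC, hF⟩ := ihF
    obtain ⟨K, hK, hG⟩ := ihG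
    refine ⟨C + K, by positivity, fun τ hτ ξ => ?_⟩
    rw [add_mul]
    exact (abs_add_le _ _).trans (add_le_add (hF τ hτ ξ) (hG τ hτ ξ))

/-- The iterated derivatives of a quotient of exponential sums. -/
theorem iteratedDeriv_div {N D : ℝ → ℝ → ℝ} (hN : IsExpSum a b N) (hD : IsExpSum a₁ b₁ D)
    (hD0 : ∀ τ ξ, D τ ξ ≠ 0) (m : ℕ) :
    ∃ P, IsExpSum (a + m * a₁) (b + m * b₁) P ∧
      ∀ τ, iteratedDeriv m (fun y => N τ y / D τ y) = fun ξ => P τ ξ / D τ ξ ^ (m + 1) := by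
  induction m with
  | zero => exact ⟨N, by simpa using hN, fun τ => by simp⟩
  | succ m ih =>
    obtain ⟨P, hP, hPD⟩ := ih
    obtain ⟨P', hP', hdP⟩ := hP.exists_hasDerivAt
    obtain ⟨D', hD', hdD⟩ := hD.exists_hasDerivAt
    refine ⟨_, ((hP'.mul hD).sub ((hP.mul hD').const_mul (m + 1))).mono
      (by push_cast; linarith) (by push_cast; linarith), fun τ => ?_⟩
    rw [iteratedDeriv_succ, hPD τ]
    funext ξ
    have h0 := hD0 τ ξ
    rw [((hdP τ ξ).fun_div ((hdD τ ξ).fun_pow (m + 1)) (pow_ne_zero _ h0)).deriv]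
    push_cast
    field_simp
    ring

end IsExpSum

theorem exp_abs_le_two_mul_cosh_s13 (x : ℝ) : Real.exp |x| ≤ 2 * Real.cosh x := by
  rw [← Real.cosh_abs, Real.cosh_eq]
  linarith [Real.exp_pos (-|x|)]

/-- The first spatial derivative of `ψ`. -/
noncomputable def ψDeriv (ξ τ : ℝ) : ℝ :=
  (1/8) * (2 * Real.sinh (ξ/2) * Real.exp (τ/4) + Real.sinh ξ * Real.exp τ)

/-- The second spatial derivative of `ψ`. -/
noncomputable def ψDeriv₂ (ξ τ : ℝ) : ℝ :=
  (1/8) * (Real.cosh (ξ/2) * Real.exp (τ/4) + Real.cosh ξ * Real.exp τ)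

/-- The third spatial derivative of `ψ`. -/
noncomputable def ψDeriv₃ (ξ τ : ℝ) : ℝ :=
  (1/8) * (1/2 * Real.sinh (ξ/2) * Real.exp (τ/4) + Real.sinh ξ * Real.exp τ)

theorem ψ_pos (ξ τ : ℝ) : 0 < ψ ξ τ := by
  have := Real.cosh_pos ξ
  have := Real.cosh_pos (ξ/2)
  unfold ψ
  positivity

theorem hasDerivAt_cosh_half (ξ : ℝ) :
    HasDerivAt (fun y => Real.cosh (y/2)) (Real.sinh (ξ/2) * (1/2)) ξ :=
  ((hasDerivAt_id ξ).div_const 2).cosh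

theorem hasDerivAt_sinh_half (ξ : ℝ) :
    HasDerivAt (fun y => Real.sinh (y/2)) (Real.cosh (ξ/2) * (1/2)) ξ :=
  ((hasDerivAt_id ξ).div_const 2).sinh

theorem hasDerivAt_exp_quarter (τ : ℝ) :
    HasDerivAt (fun s => Real.exp (s/4)) (Real.exp (τ/4) * (1/4)) τ :=
  ((hasDerivAt_id τ).div_const 4).exp

theorem hasDerivAt_ψ_space (ξ τ : ℝ) : HasDerivAt (fun y => ψ y τ) (ψDeriv ξ τ) ξ := by
  refine ((((((hasDerivAt_cosh_half ξ).const_mul 4).mul_const (Real.exp (τ/4))).const_add 3).add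
    ((Real.hasDerivAt_cosh ξ).mul_const (Real.exp τ))).const_mul (1/8)).congr_deriv ?_
  unfold ψDeriv
  ring

theorem hasDerivAt_ψDeriv_space (ξ τ : ℝ) :
    HasDerivAt (fun y => ψDeriv y τ) (ψDeriv₂ ξ τ) ξ := by
  refine (((((hasDerivAt_sinh_half ξ).const_mul 2).mul_const (Real.exp (τ/4))).add
    ((Real.hasDerivAt_sinh ξ).mul_const (Real.exp τ))).const_mul (1/8)).congr_deriv ?_
  unfold ψDeriv₂
  ring

theorem hasDerivAt_ψDeriv₂_space (ξ τ : ℝ) :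
    HasDerivAt (fun y => ψDeriv₂ y τ) (ψDeriv₃ ξ τ) ξ := by
  refine ((((hasDerivAt_cosh_half ξ).mul_const (Real.exp (τ/4))).add
    ((Real.hasDerivAt_cosh ξ).mul_const (Real.exp τ))).const_mul (1/8)).congr_deriv ?_
  unfold ψDeriv₃
  ring

theorem hasDerivAt_ψ_time (ξ τ : ℝ) : HasDerivAt (fun s => ψ ξ s) (ψDeriv₂ ξ τ) τ := by
  refine (((((hasDerivAt_exp_quarter τ).const_mul (4 * Real.cosh (ξ/2))).const_add 3).add
    ((Real.hasDerivAt_exp τ).const_mul (Real.cosh ξ))).const_mul (1/8)).congr_deriv ?_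
  unfold ψDeriv₂
  ring

theorem hasDerivAt_ψDeriv_time (ξ τ : ℝ) : HasDerivAt (fun s => ψDeriv ξ s) (ψDeriv₃ ξ τ) τ := by
  refine ((((hasDerivAt_exp_quarter τ).const_mul (2 * Real.sinh (ξ/2))).add
    ((Real.hasDerivAt_exp τ).const_mul (Real.sinh ξ))).const_mul (1/8)).congr_deriv ?_
  unfold ψDeriv₃
  ring

theorem w_eq (ξ τ : ℝ) : w ξ τ = ψDeriv ξ τ / ψ ξ τ := by
  rw [w, (hasDerivAt_ψ_space ξ τ).deriv]

theorem deriv_deriv_ψ (ξ τ : ℝ) : deriv (deriv (fun y => ψ y τ)) ξ = ψDeriv₂ ξ τ := by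
  rw [funext fun y => (hasDerivAt_ψ_space y τ).deriv, (hasDerivAt_ψDeriv_space ξ τ).deriv]

theorem deriv_w (ξ τ : ℝ) :
    deriv (fun y => w y τ) ξ =
      (ψDeriv₂ ξ τ * ψ ξ τ - ψDeriv ξ τ * ψDeriv ξ τ) / ψ ξ τ ^ 2 := by
  simp only [w_eq]
  exact ((hasDerivAt_ψDeriv_space ξ τ).fun_div (hasDerivAt_ψ_space ξ τ) (ψ_pos ξ τ).ne').deriv

theorem hasDerivAt_w_time (ξ τ : ℝ) :
    HasDerivAt (fun s => w ξ s)
      (2 * w ξ τ * deriv (fun y => w y τ) ξ + deriv (deriv (fun y => w y τ)) ξ) τ := by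
  have h0 := (ψ_pos ξ τ).ne'
  have h0' := hasDerivAt_ψ_space ξ τ
  have h1 := hasDerivAt_ψDeriv_space ξ τ
  rw [funext fun y => deriv_w y τ,
    ((((hasDerivAt_ψDeriv₂_space ξ τ).fun_mul h0').fun_sub (h1.fun_mul h1)).fun_div
      (h0'.fun_pow 2) (pow_ne_zero 2 h0)).deriv]
  simp only [w_eq]
  refine ((hasDerivAt_ψDeriv_time ξ τ).fun_div (hasDerivAt_ψ_time ξ τ) h0).congr_deriv ?_
  field_simp
  ring

theorem cosh_half_eq (ξ : ℝ) : Real.cosh (ξ/2) = 2 * Real.cosh (ξ/4) ^ 2 - 1 := by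
  rw [show ξ/2 = 2 * (ξ/4) by ring, Real.cosh_two_mul, Real.sinh_sq]
  ring

theorem sinh_half_eq (ξ : ℝ) : Real.sinh (ξ/2) = 2 * Real.sinh (ξ/4) * Real.cosh (ξ/4) := by
  rw [show ξ/2 = 2 * (ξ/4) by ring, Real.sinh_two_mul]

theorem ψ_zero (ξ : ℝ) : ψ ξ 0 = Real.cosh (ξ/4) ^ 4 := by
  have h : Real.cosh ξ = 2 * Real.cosh (ξ/2) ^ 2 - 1 := by
    rw [show Real.cosh ξ = Real.cosh (2 * (ξ/2)) by ring_nf, Real.cosh_two_mul, Real.sinh_sq]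
    ring
  rw [ψ, h, cosh_half_eq, zero_div, Real.exp_zero]
  ring

theorem w_zero (ξ : ℝ) : w ξ 0 = Real.tanh (ξ/4) := by
  have h : Real.sinh ξ = 2 * Real.sinh (ξ/2) * Real.cosh (ξ/2) := by
    rw [show Real.sinh ξ = Real.sinh (2 * (ξ/2)) by ring_nf, Real.sinh_two_mul]
  have hc := (Real.cosh_pos (ξ/4)).ne'
  rw [w_eq, ψ_zero, ψDeriv, h, sinh_half_eq, cosh_half_eq, zero_div, Real.exp_zero,
    Real.tanh_eq_sinh_div_cosh]
  field_simp
  ring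

/-- The denominator `8 ψ(ξ,τ) cosh ξ` of `w - tanh`. -/
noncomputable def errDen (τ ξ : ℝ) : ℝ := 8 * ψ ξ τ * Real.cosh ξ

/-- The numerator of `w - tanh` over `errDen`. -/
noncomputable def errNum (τ ξ : ℝ) : ℝ :=
  8 * (ψDeriv ξ τ * Real.cosh ξ - ψ ξ τ * Real.sinh ξ)

theorem errDen_pos (τ ξ : ℝ) : 0 < errDen τ ξ :=
  mul_pos (mul_pos (by norm_num) (ψ_pos ξ τ)) (Real.cosh_pos ξ)

theorem w_sub_tanh (ξ τ : ℝ) : w ξ τ - Real.tanh ξ = errNum τ ξ / errDen τ ξ := by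
  have h0 := (ψ_pos ξ τ).ne'
  have hc := (Real.cosh_pos ξ).ne'
  rw [w_eq, Real.tanh_eq_sinh_div_cosh, errNum, errDen]
  field_simp

theorem le_errDen (τ ξ : ℝ) : Real.exp τ * Real.exp (2 * |ξ|) / 4 ≤ errDen τ ξ := by
  have hc := Real.cosh_pos ξ
  have hc' := Real.cosh_pos (ξ/2)
  have hexp : Real.exp (2 * |ξ|) ≤ 4 * Real.cosh ξ ^ 2 := by
    rw [two_mul, Real.exp_add]
    have := mul_self_le_mul_self (Real.exp_pos |ξ|).le (exp_abs_le_two_mul_cosh_s13 ξ)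
    linarith
  have hψ : Real.cosh ξ * Real.exp τ ≤ 8 * ψ ξ τ := by
    have : 0 < 4 * Real.cosh (ξ/2) * Real.exp (τ/4) := by positivity
    unfold ψ
    linarith
  calc Real.exp τ * Real.exp (2 * |ξ|) / 4
      ≤ Real.exp τ * (4 * Real.cosh ξ ^ 2) / 4 := by gcongr
    _ = Real.cosh ξ * Real.exp τ * Real.cosh ξ := by ring
    _ ≤ errDen τ ξ := mul_le_mul_of_nonneg_right hψ hc.le

theorem isExpSum_errDen : IsExpSum 1 2 errDen := by
  have h₁ : IsExpSum 1 2 _ := ((IsExpSum.cosh 1).const_mul 3).mono (by norm_num) (by norm_num)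
  have h₂ : IsExpSum 1 2 _ :=
    (((IsExpSum.cosh (1/2)).mul (IsExpSum.exp_time (1/4))).mul (IsExpSum.cosh 1)).const_mul 4
      |>.mono (by norm_num) (by norm_num [abs_of_pos])
  have h₃ : IsExpSum 1 2 _ :=
    (((IsExpSum.cosh 1).mul (IsExpSum.exp_time 1)).mul (IsExpSum.cosh 1)).mono
      (by norm_num) (by norm_num)
  convert (h₁.add h₂).add h₃ using 3 with τ ξ
  simp only [errDen, ψ, one_mul, one_div_mul_eq_div]
  ring

theorem isExpSum_errNum : IsExpSum (1/4) (3/2) errNum := by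
  have h₁ : IsExpSum (1/4) (3/2) _ :=
    (((IsExpSum.sinh (1/2)).mul (IsExpSum.exp_time (1/4))).mul (IsExpSum.cosh 1)).const_mul 2
      |>.mono (by norm_num) (by norm_num [abs_of_pos])
  have h₂ : IsExpSum (1/4) (3/2) _ :=
    ((IsExpSum.sinh 1).const_mul 3).mono (by norm_num) (by norm_num)
  have h₃ : IsExpSum (1/4) (3/2) _ :=
    (((IsExpSum.cosh (1/2)).mul (IsExpSum.exp_time (1/4))).mul (IsExpSum.sinh 1)).const_mul 4
      |>.mono (by norm_num) (by norm_num [abs_of_pos])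
  convert (h₁.sub h₂).sub h₃ using 3 with τ ξ
  simp only [errNum, ψDeriv, ψ, one_mul, one_div_mul_eq_div]
  ring

theorem exists_bound_iteratedDeriv_w_sub_tanh (m : ℕ) :
    ∃ C : ℝ, 0 < C ∧ ∀ τ : ℝ, 0 ≤ τ → ∀ ξ : ℝ,
      |Real.exp (|ξ|/2) * iteratedDeriv m (fun y => w y τ - Real.tanh y) ξ| ≤
        C * Real.exp (-3 * τ / 4) := by
  obtain ⟨P, hP, hPD⟩ := isExpSum_errNum.iteratedDeriv_div isExpSum_errDen
    (fun τ ξ => (errDen_pos τ ξ).ne') m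
  obtain ⟨C, hC, hbound⟩ := hP.exists_bound
  refine ⟨C * 4 ^ (m + 1), by positivity, fun τ hτ ξ => ?_⟩
  have hD := pow_pos (errDen_pos τ ξ) (m + 1)
  have hpow : (Real.exp τ * Real.exp (2 * |ξ|) / 4) ^ (m + 1) ≤ errDen τ ξ ^ (m + 1) := by
    gcongr
    exact le_errDen τ ξ
  simp only [w_sub_tanh]
  rw [hPD τ, abs_mul, abs_div, abs_of_pos hD, abs_of_pos (Real.exp_pos _), ← mul_div_assoc,
    div_le_iff₀ hD]
  calc Real.exp (|ξ|/2) * |P τ ξ|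
      ≤ Real.exp (|ξ|/2) *
          (C * (Real.exp ((1/4 + m * 1) * τ) * Real.exp ((3/2 + m * 2) * |ξ|))) := by
        gcongr
        exact hbound τ hτ ξ
    _ = C * 4 ^ (m + 1) * Real.exp (-3 * τ / 4) *
          (Real.exp τ * Real.exp (2 * |ξ|) / 4) ^ (m + 1) := by
        rw [div_pow, mul_pow, ← Real.exp_nat_mul, ← Real.exp_nat_mul]
        field_simp
        simp only [← Real.exp_add]
        congr 1
        push_cast
        ring
    _ ≤ _ := by gcongr

/-- Lemma 4: `ψ` solves the heat equation with data `cosh⁴(ξ/4)`, `w = ψ_ξ/ψ` solves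
the viscous Burgers equation with data `tanh(ξ/4)`, and `w` converges to the viscous
shock `tanh(ξ)` exponentially fast, with exponential spatial weight, in every `C^m`. -/
theorem explicit_solution_convergence :
    -- (i) heat equation and initial data
    (∀ ξ τ : ℝ, HasDerivAt (fun s => ψ ξ s) (deriv (deriv (fun y => ψ y τ)) ξ) τ) ∧
    (∀ ξ : ℝ, ψ ξ 0 = Real.cosh (ξ/4) ^ 4) ∧
    -- (ii) Burgers equation and initial data
    (∀ ξ τ : ℝ, HasDerivAt (fun s => w ξ s)
      (2 * w ξ τ * deriv (fun y => w y τ) ξ + deriv (deriv (fun y => w y τ)) ξ) τ) ∧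
    (∀ ξ : ℝ, w ξ 0 = Real.tanh (ξ/4)) ∧
    -- (iii) weighted exponential convergence to the viscous shock
    (∀ m : ℕ, ∃ C : ℝ, 0 < C ∧ ∀ τ : ℝ, 0 ≤ τ → ∀ ξ : ℝ,
      |Real.exp (|ξ|/2) * iteratedDeriv m (fun y => w y τ - Real.tanh y) ξ| ≤
        C * Real.exp (-3 * τ / 4)) := by
  exact ⟨fun ξ τ => by rw [deriv_deriv_ψ]; exact hasDerivAt_ψ_time ξ τ, ψ_zero,
    hasDerivAt_w_time, w_zero, exists_bound_iteratedDeriv_w_sub_tanh⟩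
end

section
/- Let ψ(ξ,τ) = (1/8)(3 + 4 cosh(ξ/2) e^{τ/4} + cosh(ξ) e^{τ}), w(ξ,τ) = ∂_ξψ/ψ, and for k > 0 define u(x,t) = -4k w(4kx, 16k²t) and u_∞(x) = -4k tanh(4kx). Fix δ > 0. Then there exist K > 0 and C > 0 such that for all k ≥ K: sup_{x ∈ ℝ} |u(x,t) - u_∞(x)| ≤ C k^{-δ} for all t ≥ T_* := (1+δ) log(k)/(12 k²). -/
open Real

theorem hasDerivAt_ψ (ξ τ : ℝ) :
    HasDerivAt (fun y => ψ y τ)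
      ((1/8) * (2 * Real.sinh (ξ/2) * Real.exp (τ/4) + Real.sinh ξ * Real.exp τ)) ξ := by
  have h₁ : HasDerivAt (fun y : ℝ => Real.cosh (y/2)) (Real.sinh (ξ/2) * (1/2)) ξ :=
    ((hasDerivAt_id ξ).div_const 2).cosh
  have h := ((((h₁.const_mul 4).mul_const (Real.exp (τ/4))).const_add 3).add
    ((Real.hasDerivAt_cosh ξ).mul_const (Real.exp τ))).const_mul (1/8)
  refine h.congr_deriv ?_
  ring

theorem abs_sinh_le_cosh (x : ℝ) : |Real.sinh x| ≤ Real.cosh x :=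
  abs_le_of_sq_le_sq (by linarith [Real.cosh_sq x]) (Real.cosh_pos x).le

/-- The Cole–Hopf solution `w` converges to the shock `tanh` at the rate `e^{-3τ/4}`, uniformly
in space. -/
theorem abs_w_sub_tanh_le (ξ : ℝ) {τ : ℝ} (hτ : 0 ≤ τ) :
    |w ξ τ - Real.tanh ξ| ≤ 9 / Real.exp (3/4 * τ) := by
  have hE : 1 ≤ Real.exp (τ/4) := Real.one_le_exp (by positivity)
  have hE4 : Real.exp τ = Real.exp (τ/4) ^ 4 := by
    rw [← Real.exp_nat_mul]; congr 1; push_cast; ring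
  have hE3 : Real.exp (3/4 * τ) = Real.exp (τ/4) ^ 3 := by
    rw [← Real.exp_nat_mul]; congr 1; push_cast; ring
  have hc : 1 ≤ Real.cosh ξ := Real.one_le_cosh ξ
  have hc₂ : 1 ≤ Real.cosh (ξ/2) := Real.one_le_cosh _
  have hcc : Real.cosh (ξ/2) ≤ Real.cosh ξ := by
    rw [Real.cosh_le_cosh, abs_div, abs_two]
    linarith [abs_nonneg ξ]
  have hs := abs_sinh_le_cosh ξ
  have hs₂ := (abs_sinh_le_cosh (ξ/2)).trans hcc
  rw [w, (hasDerivAt_ψ ξ τ).deriv, ψ, Real.tanh_eq_sinh_div_cosh, hE3, hE4]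
  generalize Real.exp (τ/4) = E at *
  generalize Real.cosh ξ = c at *
  generalize Real.sinh ξ = s at *
  generalize Real.cosh (ξ/2) = c₂ at *
  generalize Real.sinh (ξ/2) = s₂ at *
  have hD : 0 < 3 + 4 * c₂ * E + c * E ^ 4 := by positivity
  have hnum : |E * (2 * (s₂ * c) - 4 * (s * c₂)) - 3 * s| ≤ 9 * (c * c * E) := by
    have h₁ : |s₂ * c| ≤ c * c := by
      rw [abs_mul, abs_of_pos (by linarith : 0 < c)]; gcongr
    have h₂ : |s * c₂| ≤ c * c := by
      rw [abs_mul, abs_of_pos (by linarith : 0 < c₂)]; gcongr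
    have h₃ : |2 * (s₂ * c) - 4 * (s * c₂)| ≤ 6 * (c * c) := by
      rw [abs_le] at *; constructor <;> linarith
    have h₄ : |E * (2 * (s₂ * c) - 4 * (s * c₂))| ≤ E * (6 * (c * c)) := by
      rw [abs_mul, abs_of_pos (by linarith : 0 < E)]; gcongr
    have h₅ : c ≤ c * c * E := by nlinarith [mul_le_mul hc hE (by norm_num) (by linarith)]
    rw [abs_le] at *
    constructor <;> linarith
  have heq : 1/8 * (2 * s₂ * E + s * E ^ 4) / (1/8 * (3 + 4 * c₂ * E + c * E ^ 4)) - s / c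
      = (E * (2 * (s₂ * c) - 4 * (s * c₂)) - 3 * s) / ((3 + 4 * c₂ * E + c * E ^ 4) * c) := by
    field_simp
    ring
  rw [heq, abs_div, abs_of_pos (by positivity : 0 < (3 + 4 * c₂ * E + c * E ^ 4) * c),
    div_le_div_iff₀ (by positivity) (by positivity)]
  calc _ ≤ 9 * (c * c * E) * E ^ 3 := by gcongr
    _ = 9 * ((c * E ^ 4) * c) := by ring
    _ ≤ _ := by
      gcongr
      have : 0 < c₂ * E := by positivity
      linarith

/-- Corollary 2: the Burgers solution `u(x,t) = -4k w(4kx, 16k²t)` with initial data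
`-4k tanh(kx)` is within `C k^{-δ}` of the viscous shock `u_∞(x) = -4k tanh(4kx)` for
all `t ≥ T_* = (1+δ)log(k)/(12k²)`. -/
theorem shock_convergence_instantaneous_data (δ : ℝ) (hδ : 0 < δ) :
    ∃ K C : ℝ, 0 < K ∧ 0 < C ∧
      ∀ k : ℝ, K ≤ k →
        ∀ t : ℝ, (1 + δ) * Real.log k / (12 * k ^ 2) ≤ t →
          ∀ x : ℝ,
            |(-4) * k * w (4*k*x) (16*k^2*t) - ((-4) * k * Real.tanh (4*k*x))| ≤
              C * k ^ (-δ) := by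
  refine ⟨1, 36, one_pos, by norm_num, fun k hk t ht x => ?_⟩
  have hk0 : 0 < k := by linarith
  have hτ : 4 / 3 * ((1 + δ) * Real.log k) ≤ 16 * k ^ 2 * t := by
    rw [div_le_iff₀ (by positivity)] at ht
    linarith
  have hlog : 0 ≤ (1 + δ) * Real.log k := mul_nonneg (by linarith) (Real.log_nonneg hk)
  have hexp : k ^ (1 + δ) ≤ Real.exp (3/4 * (16 * k ^ 2 * t)) := by
    rw [Real.rpow_def_of_pos hk0]
    exact Real.exp_le_exp.mpr (by linarith)
  have hpow : 0 < k ^ (1 + δ) := Real.rpow_pos_of_pos hk0 _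
  calc _ = 4 * k * |w (4*k*x) (16*k^2*t) - Real.tanh (4*k*x)| := by
        rw [← mul_sub, abs_mul, abs_mul, abs_of_pos hk0]; norm_num
    _ ≤ 4 * k * (9 / k ^ (1 + δ)) := by
        gcongr
        exact (abs_w_sub_tanh_le _ (by linarith)).trans (by gcongr)
    _ = 36 * k ^ (-δ) := by
        rw [Real.rpow_add hk0, Real.rpow_one, Real.rpow_neg hk0.le]
        field_simp
        norm_num
end
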